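/- Fix integers m, n ≥ 1 and d ∈ ℕ. The ℚ(q)-linear map Ω̃ : 𝒱^ı_{m|n,d} → 𝒱_{2m|n,d} determined by Ω̃(t^{(A)}) = t^{(ΩA)}, where ΩA is the submatrix of A consisting of its columns indexed by {1/2, 3/2, …, n−1/2}, is a linear bijection and satisfies: (1) Ω̃(t^{(A)} B^R_i) = Ω̃(t^{(A)}) F_i and Ω̃(t^{(A)} B^R_{−i}) = Ω̃(t^{(A)}) E_i for every i ∈ {1,…,n−1} and A ∈ Ξ^ı_{m|n,d}; (2) Ω̃(B^L_i t^{(A)}) = (F_i + E_{−i} K_i^{−1}) Ω̃(t^{(A)}) for every i ∈ 𝕀_{2m−1} with i ≠ 0; (3) Ω̃(B^L_0 t^{(A)}) = (F_0 + q^{−1} E_0 K_0^{−1} + K_0^{−1}) Ω̃(t^{(A)}). (In other words, the ı-type Howe duality space 𝒱^ı_{m|n,d} is isomorphic, compatibly with the see-saw pair, to the type A q-Howe duality space 𝒱_{2m|n,d}.) -/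

import Mathlib

open scoped BigOperators Classical

noncomputable section

/-- The base field `ℚ(q)`. -/
abbrev K : Type := RatFunc ℚ

/-- The indeterminate `q`. -/
def q : K := RatFunc.X

/-- The quantum integer `[r] = (q^r - q^{-r})/(q - q^{-1})`. -/
def qint (r : ℤ) : K := (q ^ r - q ^ (-r)) / (q - q⁻¹)

/-- The quantum factorial `[r]!`. -/
def qfac : ℕ → K
  | 0 => 1
  | n+1 => qfac n * qint (n+1)

/-- The index set `𝕀_N = {-(N-1)/2, -(N-3)/2, …, (N-1)/2}` as a finite set of rationals. -/
def II (N : ℕ) : Finset ℚ := (Finset.range N).image (fun k : ℕ => (k : ℚ) - ((N : ℚ) - 1) / 2)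

theorem II_neg {N : ℕ} {a : ℚ} (h : a ∈ II N) : -a ∈ II N := by
  obtain ⟨k, hk, hv⟩ := Finset.mem_image.mp h
  rw [Finset.mem_range] at hk
  refine Finset.mem_image.mpr ⟨N - 1 - k, Finset.mem_range.mpr (by omega), ?_⟩
  have h1 : ((N - 1 - k : ℕ) : ℚ) = (N : ℚ) - 1 - (k : ℚ) := by
    have h2 : (N : ℚ) = ((N - 1 - k : ℕ) : ℚ) + (k : ℚ) + 1 := by
      exact_mod_cast congrArg (Nat.cast : ℕ → ℚ) (by omega : N = (N - 1 - k) + k + 1)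
    linarith
  rw [h1, ← hv]; ring

/-- Matrices with rational row/column labels and natural number entries. -/
abbrev Mat : Type := ℚ → ℚ → ℕ

/-- The θ-elementary matrix `E^θ_{r,c} = E_{r,c} + E_{-r,-c}`. -/
def chiM (r c : ℚ) : Mat := fun x y =>
  (if x = r ∧ y = c then 1 else 0) + (if x = -r ∧ y = -c then 1 else 0)

/-- `A + E^θ_{p,j} - E^θ_{p',j'}` (truncated ℕ-subtraction; only used where the
corresponding q-integer coefficient vanishes otherwise). -/
def matMove (A : Mat) (p j p' j' : ℚ) : Mat := fun x y => A x y + chiM p j x y - chiM p' j' x y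

/-- Free `ℚ(q)`-vector space on the set of matrices `P`. -/
abbrev FM (P : Set Mat) : Type := {A : Mat // A ∈ P} →₀ K

/-- Basis vector `t^{(A)}` (zero if `A ∉ P`). -/
def tP (P : Set Mat) (A : Mat) : FM P := if h : A ∈ P then Finsupp.single ⟨A, h⟩ 1 else 0

/-- Linear operator on `FM P` defined by its values on basis vectors. -/
def opOf {P : Set Mat} (f : Mat → FM P) : FM P →ₗ[K] FM P :=
  Finsupp.lift (FM P) K {A : Mat // A ∈ P} fun A => f A.1

/-- The set `Ξ^ı_{m|n,d}`: matrices supported on `𝕀_{2m} × 𝕀_{2n}`, centro-symmetric,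
with total entry sum `2d`. -/
def Xiι (m n d : ℕ) : Set Mat :=
  {A | (∀ i j, A i j ≠ 0 → i ∈ II (2*m) ∧ j ∈ II (2*n)) ∧
       (∀ i j, A i j = A (-i) (-j)) ∧
       ∑ i ∈ II (2*m), ∑ j ∈ II (2*n), A i j = 2*d}

/-- Left operator `B^L_i` (ı-case), for `i ∈ 𝕀_{2m-1}`, `i ≠ 0`. -/
def BLι (n : ℕ) (P : Set Mat) (i : ℚ) : FM P →ₗ[K] FM P :=
  opOf fun A => ∑ j ∈ II (2*n),
    (q ^ ((∑ k ∈ (II (2*n)).filter (fun k => j ≤ k), ((A (i+1/2) k : ℤ) - (A (i-1/2) k : ℤ))) + 1)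
      * qint (A (i-1/2) j)) • tP P (matMove A (i+1/2) j (i-1/2) j)

/-- Left operator `B^L_0` (ı-case). -/
def BL0ι (n : ℕ) (P : Set Mat) : FM P →ₗ[K] FM P :=
  opOf fun A =>
    (∑ j ∈ II (2*n),
      (q ^ ((∑ k ∈ (II (2*n)).filter (fun k => j ≤ k), ((A (1/2) k : ℤ) - (A (-(1/2)) k : ℤ)))
            + (if 0 < j then 1 else 0))
        * qint (A (-(1/2)) j)) • tP P (matMove A (1/2) j (-(1/2)) j))
    + (q ^ (∑ j ∈ (II (2*n)).filter (fun j => 0 < j), ((A (1/2) j : ℤ) - (A (-(1/2)) j : ℤ)))) • tP P A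

/-- Left Cartan operator `(d^L_r)^e` for `e = ±1` (ı-case). -/
def dLι (n : ℕ) (P : Set Mat) (r : ℚ) (e : ℤ) : FM P →ₗ[K] FM P :=
  opOf fun A => (q ^ (e * ∑ j ∈ II (2*n), (A r j : ℤ))) • tP P A

/-- Right operator `B^R_i` (ı-case), for `i ∈ 𝕀_{2n-1}`, `i ≠ 0`. -/
def BRι (m : ℕ) (P : Set Mat) (i : ℚ) : FM P →ₗ[K] FM P :=
  opOf fun A => ∑ j ∈ II (2*m),
    (q ^ (∑ k ∈ (II (2*m)).filter (fun k => j < k), ((A k (i+1/2) : ℤ) - (A k (i-1/2) : ℤ)))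
      * qint (A j (i+1/2))) • tP P (matMove A j (i-1/2) j (i+1/2))

/-- Right operator `B^R_0` (ı-case). -/
def BR0ι (m : ℕ) (P : Set Mat) : FM P →ₗ[K] FM P :=
  opOf fun A =>
    (∑ j ∈ II (2*m),
      (q ^ ((∑ k ∈ (II (2*m)).filter (fun k => j < k), ((A k (1/2) : ℤ) - (A k (-(1/2)) : ℤ)))
            + (if j < 0 then 1 else 0))
        * qint (A j (1/2))) • tP P (matMove A j (-(1/2)) j (1/2)))
    + (q ^ (∑ j ∈ (II (2*m)).filter (fun j => 0 < j), ((A j (1/2) : ℤ) - (A j (-(1/2)) : ℤ)))) • tP P A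

/-- Right Cartan operator `(d^R_r)^e` for `e = ±1` (ı-case). -/
def dRι (m : ℕ) (P : Set Mat) (r : ℚ) (e : ℤ) : FM P →ₗ[K] FM P :=
  opOf fun A => (q ^ (e * ∑ k ∈ II (2*m), (A k r : ℤ))) • tP P A

/-- The column set `{1/2, 3/2, …, n-1/2}`. -/
def JJ (n : ℕ) : Finset ℚ := (Finset.range n).image (fun k : ℕ => (k : ℚ) + 1/2)

/-- The set `Ξ_{2m|n,d}`: matrices supported on `𝕀_{2m} × {1/2,…,n-1/2}` with entry sum `d`. -/
def Xi2 (m n d : ℕ) : Set Mat :=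
  {B | (∀ i j, B i j ≠ 0 → i ∈ II (2*m) ∧ j ∈ JJ n) ∧ ∑ i ∈ II (2*m), ∑ j ∈ JJ n, B i j = d}

/-- The submatrix of `A` consisting of its columns indexed by `{1/2,…,n-1/2}`. -/
def OmegaM (n : ℕ) (A : Mat) : Mat := fun x y => if y ∈ JJ n then A x y else 0

/-- The linear map `Ω̃ : 𝒱^ı_{m|n,d} → 𝒱_{2m|n,d}`, `t^{(A)} ↦ t^{(ΩA)}`. -/
def OmegaT (m n d : ℕ) : FM (Xiι m n d) →ₗ[K] FM (Xi2 m n d) :=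
  Finsupp.lift (FM (Xi2 m n d)) K {A : Mat // A ∈ Xiι m n d} fun A =>
    tP (Xi2 m n d) (OmegaM n A.1)

/-- Plain elementary matrix `E_{r,c}` as a function. -/
def chi1 (r c : ℚ) : Mat := fun x y => if x = r ∧ y = c then 1 else 0

/-- `A + E_{p,j} - E_{p',j'}` (truncated ℕ-subtraction). -/
def matMove1 (A : Mat) (p j p' j' : ℚ) : Mat := fun x y => A x y + chi1 p j x y - chi1 p' j' x y

/-- Left operator `E_i` on `𝒱_{2m|n,d}`, for `i ∈ 𝕀_{2m-1}`. -/
def ELt (n : ℕ) (P : Set Mat) (i : ℚ) : FM P →ₗ[K] FM P :=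
  opOf fun B => ∑ j ∈ JJ n,
    (q ^ ((∑ k ∈ (JJ n).filter (fun k => k ≤ j), ((B (i-1/2) k : ℤ) - (B (i+1/2) k : ℤ))) + 1)
      * qint (B (i+1/2) j)) • tP P (matMove1 B (i-1/2) j (i+1/2) j)

/-- Left operator `F_i` on `𝒱_{2m|n,d}`, for `i ∈ 𝕀_{2m-1}`. -/
def FLt (n : ℕ) (P : Set Mat) (i : ℚ) : FM P →ₗ[K] FM P :=
  opOf fun B => ∑ j ∈ JJ n,
    (q ^ ((∑ k ∈ (JJ n).filter (fun k => j ≤ k), ((B (i+1/2) k : ℤ) - (B (i-1/2) k : ℤ))) + 1)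
      * qint (B (i-1/2) j)) • tP P (matMove1 B (i+1/2) j (i-1/2) j)

/-- Left operator `K_i^{-1}` on `𝒱_{2m|n,d}` (diagonal). -/
def KLinv (n : ℕ) (P : Set Mat) (i : ℚ) : FM P →ₗ[K] FM P :=
  opOf fun B => (q ^ (-(∑ j ∈ JJ n, ((B (i-1/2) j : ℤ) - (B (i+1/2) j : ℤ))))) • tP P B

/-- Right operator `E_i` on `𝒱_{2m|n,d}`, for `i ∈ {1,…,n-1}`. -/
def ERt (m : ℕ) (P : Set Mat) (i : ℚ) : FM P →ₗ[K] FM P :=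
  opOf fun B => ∑ j ∈ II (2*m),
    (q ^ (∑ k ∈ (II (2*m)).filter (fun k => k < j), ((B k (i-1/2) : ℤ) - (B k (i+1/2) : ℤ)))
      * qint (B j (i-1/2))) • tP P (matMove1 B j (i+1/2) j (i-1/2))

/-- Right operator `F_i` on `𝒱_{2m|n,d}`, for `i ∈ {1,…,n-1}`. -/
def FRt (m : ℕ) (P : Set Mat) (i : ℚ) : FM P →ₗ[K] FM P :=
  opOf fun B => ∑ j ∈ II (2*m),
    (q ^ (∑ k ∈ (II (2*m)).filter (fun k => j < k), ((B k (i+1/2) : ℤ) - (B k (i-1/2) : ℤ)))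
      * qint (B j (i+1/2))) • tP P (matMove1 B j (i-1/2) j (i+1/2))

theorem mem_JJ {n : ℕ} {x : ℚ} : x ∈ JJ n ↔ ∃ k : ℕ, k < n ∧ x = k + 1 / 2 := by
  simp [JJ, eq_comm]

theorem mem_II {N : ℕ} {x : ℚ} : x ∈ II N ↔ ∃ k : ℕ, k < N ∧ x = k - ((N : ℚ) - 1) / 2 := by
  simp [II, eq_comm]

theorem pos_of_mem_JJ {n : ℕ} {x : ℚ} (h : x ∈ JJ n) : 0 < x := by
  obtain ⟨k, -, rfl⟩ := mem_JJ.1 h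
  positivity

theorem neg_notMem_JJ {n : ℕ} {x : ℚ} (h : x ∈ JJ n) : -x ∉ JJ n := fun h' => by
  linarith [pos_of_mem_JJ h, pos_of_mem_JJ h']

theorem mem_II_two_mul {n : ℕ} {x : ℚ} : x ∈ II (2 * n) ↔ x ∈ JJ n ∨ -x ∈ JJ n := by
  rw [mem_II, mem_JJ, mem_JJ]
  push_cast
  constructor
  · rintro ⟨k, hk, rfl⟩
    rcases le_or_gt n k with h | h
    · obtain ⟨l, rfl⟩ := Nat.exists_eq_add_of_le h
      exact Or.inl ⟨l, by omega, by push_cast; ring⟩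
    · obtain ⟨l, rfl⟩ := Nat.exists_eq_add_of_lt h
      exact Or.inr ⟨l, by omega, by push_cast; ring⟩
  · rintro (⟨k, hk, rfl⟩ | ⟨k, hk, h⟩)
    · exact ⟨n + k, by omega, by push_cast; ring⟩
    · obtain ⟨l, rfl⟩ := Nat.exists_eq_add_of_lt hk
      exact ⟨l, by omega, by push_cast; linarith⟩

theorem mem_II_of_mem_JJ {n : ℕ} {x : ℚ} (h : x ∈ JJ n) : x ∈ II (2 * n) :=
  mem_II_two_mul.2 (Or.inl h)

theorem add_half_mem_II {m : ℕ} {i : ℚ} (h : i ∈ II (2 * m - 1)) : i + 1 / 2 ∈ II (2 * m) := by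
  obtain ⟨k, hk, rfl⟩ := mem_II.1 h
  refine mem_II.2 ⟨k + 1, by omega, ?_⟩
  rw [Nat.cast_sub (by omega)]
  push_cast; ring

theorem sub_half_mem_II {m : ℕ} {i : ℚ} (h : i ∈ II (2 * m - 1)) : i - 1 / 2 ∈ II (2 * m) := by
  obtain ⟨k, hk, rfl⟩ := mem_II.1 h
  refine mem_II.2 ⟨k, by omega, ?_⟩
  rw [Nat.cast_sub (by omega)]
  push_cast; ring

theorem zero_mem_II {m : ℕ} (hm : 1 ≤ m) : (0 : ℚ) ∈ II (2 * m - 1) := by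
  refine mem_II.2 ⟨m - 1, by omega, ?_⟩
  rw [Nat.cast_sub (by omega), Nat.cast_sub (by omega)]
  push_cast; ring

theorem add_half_mem_JJ {n i : ℕ} (h : i ≤ n - 1) (h1 : 1 ≤ i) : (i : ℚ) + 1 / 2 ∈ JJ n :=
  mem_JJ.2 ⟨i, by omega, rfl⟩

theorem sub_half_mem_JJ {n i : ℕ} (h : i ≤ n - 1) (h1 : 1 ≤ i) : (i : ℚ) - 1 / 2 ∈ JJ n := by
  obtain ⟨k, rfl⟩ := Nat.exists_eq_add_of_le' h1
  exact mem_JJ.2 ⟨k, by omega, by push_cast; ring⟩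

theorem sum_II_neg {M : Type*} [AddCommMonoid M] (N : ℕ) (f : ℚ → M) :
    ∑ j ∈ II N, f (-j) = ∑ j ∈ II N, f j :=
  Finset.sum_bij' (fun j _ => -j) (fun j _ => -j) (fun _ h => II_neg h) (fun _ h => II_neg h)
    (fun _ _ => neg_neg _) (fun _ _ => neg_neg _) (fun _ _ => rfl)

theorem sum_II_two_mul {M : Type*} [AddCommMonoid M] (n : ℕ) (f : ℚ → M) :
    ∑ j ∈ II (2 * n), f j = ∑ j ∈ JJ n, f j + ∑ j ∈ JJ n, f (-j) := by
  have hII : II (2 * n) = JJ n ∪ (JJ n).image (fun x => -x) := by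
    ext x
    rw [mem_II_two_mul, Finset.mem_union, Finset.mem_image]
    refine or_congr_right ⟨fun h => ⟨-x, h, neg_neg x⟩, ?_⟩
    rintro ⟨y, hy, rfl⟩
    rwa [neg_neg]
  have hdisj : Disjoint (JJ n) ((JJ n).image (fun x => -x)) := by
    refine Finset.disjoint_left.2 fun x hx hx' => ?_
    obtain ⟨y, hy, rfl⟩ := Finset.mem_image.1 hx'
    exact neg_notMem_JJ hy hx
  rw [hII, Finset.sum_union hdisj, Finset.sum_image fun x _ y _ h => neg_injective h]

theorem sum_II_filter_le {n : ℕ} {j : ℚ} (hj : j ∈ JJ n) (f : ℚ → ℤ) :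
    ∑ k ∈ (II (2 * n)).filter (fun k => j ≤ k), f k
      = ∑ k ∈ (JJ n).filter (fun k => j ≤ k), f k := by
  simp only [Finset.sum_filter, sum_II_two_mul]
  refine add_eq_left.2 (Finset.sum_eq_zero fun k hk => if_neg ?_)
  linarith [pos_of_mem_JJ hj, pos_of_mem_JJ hk]

theorem sum_II_filter_neg_le {n : ℕ} {j : ℚ} (hj : j ∈ JJ n) (f : ℚ → ℤ) :
    ∑ k ∈ (II (2 * n)).filter (fun k => -j ≤ k), f k
      = ∑ k ∈ JJ n, f k + ∑ k ∈ (JJ n).filter (fun k => k ≤ j), f (-k) := by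
  simp only [Finset.sum_filter, sum_II_two_mul, neg_le_neg_iff]
  congr 1
  refine Finset.sum_congr rfl fun k hk => if_pos ?_
  linarith [pos_of_mem_JJ hj, pos_of_mem_JJ hk]

theorem sum_II_filter_pos (n : ℕ) (f : ℚ → ℤ) :
    ∑ k ∈ (II (2 * n)).filter (fun k => 0 < k), f k = ∑ k ∈ JJ n, f k := by
  simp only [Finset.sum_filter, sum_II_two_mul]
  rw [Finset.sum_congr rfl fun k hk => if_pos (pos_of_mem_JJ hk), add_eq_left]
  refine Finset.sum_eq_zero fun k hk => if_neg ?_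
  linarith [pos_of_mem_JJ hk]

theorem sum_II_filter_neg_lt (N : ℕ) (j : ℚ) (f : ℚ → ℤ) :
    ∑ k ∈ (II N).filter (fun k => -j < k), f k
      = ∑ k ∈ (II N).filter (fun k => k < j), f (-k) := by
  simp only [Finset.sum_filter]
  rw [← sum_II_neg]
  simp only [neg_lt_neg_iff]

/-- Centro-symmetric matrices supported on `𝕀_{2m} × 𝕀_{2n}`, with no condition on the entry sum. -/
def SymSupp (m n : ℕ) (A : Mat) : Prop :=
  (∀ i j, A i j ≠ 0 → i ∈ II (2 * m) ∧ j ∈ II (2 * n)) ∧ ∀ i j, A i j = A (-i) (-j)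

theorem symSupp_of_mem {m n d : ℕ} {A : Mat} (hA : A ∈ Xiι m n d) : SymSupp m n A :=
  ⟨hA.1, hA.2.1⟩

theorem OmegaM_of_mem {n : ℕ} {y : ℚ} (hy : y ∈ JJ n) (A : Mat) (x : ℚ) :
    OmegaM n A x y = A x y := if_pos hy

theorem SymSupp.sum_eq {m n : ℕ} {A : Mat} (hA : SymSupp m n A) :
    ∑ i ∈ II (2 * m), ∑ j ∈ II (2 * n), A i j
      = 2 * ∑ i ∈ II (2 * m), ∑ j ∈ JJ n, OmegaM n A i j := by
  have h : ∑ i ∈ II (2 * m), ∑ j ∈ JJ n, A i (-j) = ∑ i ∈ II (2 * m), ∑ j ∈ JJ n, A i j := by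
    rw [← sum_II_neg]
    simp only [← hA.2]
  simp only [sum_II_two_mul n, Finset.sum_add_distrib, h]
  rw [← two_mul]
  congr 1
  exact Finset.sum_congr rfl fun i _ => Finset.sum_congr rfl fun j hj => (OmegaM_of_mem hj A i).symm

theorem SymSupp.mem_iff {m n d : ℕ} {A : Mat} (hA : SymSupp m n A) :
    A ∈ Xiι m n d ↔ OmegaM n A ∈ Xi2 m n d := by
  have hsum := hA.sum_eq
  constructor
  · rintro ⟨-, -, h⟩
    refine ⟨fun i j hij => ?_, by omega⟩
    by_cases hj : j ∈ JJ n
    · rw [OmegaM_of_mem hj] at hij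
      exact ⟨(hA.1 i j hij).1, hj⟩
    · exact absurd (if_neg hj) hij
  · rintro ⟨-, h⟩
    exact ⟨hA.1, hA.2, by omega⟩

theorem chiM_neg_neg (r c x y : ℚ) : chiM r c (-x) (-y) = chiM r c x y := by
  simp only [chiM, neg_eq_iff_eq_neg, neg_neg]
  exact Nat.add_comm _ _

theorem SymSupp.matMove {m n : ℕ} {A : Mat} (hA : SymSupp m n A) {p j : ℚ}
    (hp : p ∈ II (2 * m)) (hj : j ∈ II (2 * n)) (p' j' : ℚ) :
    SymSupp m n (matMove A p j p' j') := by
  refine ⟨fun x y h => ?_, fun x y => ?_⟩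
  · by_cases hxy : A x y = 0
    · have hc : chiM p j x y ≠ 0 := fun hc => h (by simp [_root_.matMove, hxy, hc])
      by_cases h1 : x = p ∧ y = j
      · exact h1.1 ▸ h1.2 ▸ ⟨hp, hj⟩
      · by_cases h2 : x = -p ∧ y = -j
        · rw [h2.1, h2.2]
          exact ⟨II_neg hp, II_neg hj⟩
        · exact absurd (by simp [chiM, h1, h2]) hc
    · exact hA.1 x y hxy
  · simp only [_root_.matMove, chiM_neg_neg, ← hA.2]

theorem chiM_of_mem {n : ℕ} {c y : ℚ} (hc : c ∈ JJ n) (hy : y ∈ JJ n) (r x : ℚ) :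
    chiM r c x y = chi1 r c x y := by
  have h : y ≠ -c := by
    rintro rfl
    exact neg_notMem_JJ hc hy
  simp [chiM, chi1, h]

theorem chiM_neg_of_mem {n : ℕ} {c y : ℚ} (hc : c ∈ JJ n) (hy : y ∈ JJ n) (r x : ℚ) :
    chiM r (-c) x y = chi1 (-r) c x y := by
  rw [← chiM_of_mem hc hy]
  simp only [chiM, neg_neg]
  exact Nat.add_comm _ _

theorem chi1_of_notMem {n : ℕ} {c y : ℚ} (hc : c ∈ JJ n) (hy : y ∉ JJ n) (r x : ℚ) :
    chi1 r c x y = 0 :=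
  if_neg fun h : x = r ∧ y = c => hy (h.2 ▸ hc)

theorem OmegaM_matMove {n : ℕ} {j j' : ℚ} (hj : j ∈ JJ n) (hj' : j' ∈ JJ n) (A : Mat) (p p' : ℚ) :
    OmegaM n (matMove A p j p' j') = matMove1 (OmegaM n A) p j p' j' := by
  funext x y
  by_cases hy : y ∈ JJ n
  · simp [OmegaM, matMove, matMove1, hy, chiM_of_mem hj hy, chiM_of_mem hj' hy]
  · simp [OmegaM, matMove1, hy, chi1_of_notMem hj hy]

theorem OmegaM_matMove_neg {n : ℕ} {j j' : ℚ} (hj : j ∈ JJ n) (hj' : j' ∈ JJ n) (A : Mat)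
    (p p' : ℚ) :
    OmegaM n (matMove A p (-j) p' (-j')) = matMove1 (OmegaM n A) (-p) j (-p') j' := by
  funext x y
  by_cases hy : y ∈ JJ n
  · simp [OmegaM, matMove, matMove1, hy, chiM_neg_of_mem hj hy, chiM_neg_of_mem hj' hy]
  · simp [OmegaM, matMove1, hy, chi1_of_notMem hj hy]

theorem opOf_single {P : Set Mat} (f : Mat → FM P) (A : {A : Mat // A ∈ P}) :
    opOf f (Finsupp.single A 1) = f A.1 := by
  simp [opOf]

theorem opOf_tP {P : Set Mat} (f : Mat → FM P) {A : Mat} (hA : A ∈ P) :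
    opOf f (tP P A) = f A := by
  rw [tP, dif_pos hA, opOf_single]

theorem OmegaT_single (m n d : ℕ) (A : {A : Mat // A ∈ Xiι m n d}) :
    OmegaT m n d (Finsupp.single A 1) = tP (Xi2 m n d) (OmegaM n A.1) := by
  simp [OmegaT]

theorem OmegaT_tP {m n : ℕ} (d : ℕ) {A : Mat} (hA : SymSupp m n A) :
    OmegaT m n d (tP (Xiι m n d) A) = tP (Xi2 m n d) (OmegaM n A) := by
  by_cases h : A ∈ Xiι m n d
  · rw [tP, dif_pos h, OmegaT_single]
  · rw [tP, dif_neg h, tP, dif_neg (mt hA.mem_iff.2 h), map_zero]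

/-- The centro-symmetric extension of a matrix supported on positive columns. -/
def symExt (B : Mat) : Mat := fun x y => B x y + B (-x) (-y)

theorem symSupp_symExt {m n d : ℕ} {B : Mat} (hB : B ∈ Xi2 m n d) : SymSupp m n (symExt B) := by
  refine ⟨fun x y h => ?_, fun x y => by simp [symExt, add_comm]⟩
  by_cases h1 : B x y = 0
  · have h2 := hB.1 (-x) (-y) fun h2 => h (by simp [symExt, h1, h2])
    exact ⟨neg_neg x ▸ II_neg h2.1, neg_neg y ▸ II_neg (mem_II_of_mem_JJ h2.2)⟩
  · exact ⟨(hB.1 x y h1).1, mem_II_of_mem_JJ (hB.1 x y h1).2⟩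

theorem OmegaM_symExt {m n d : ℕ} {B : Mat} (hB : B ∈ Xi2 m n d) : OmegaM n (symExt B) = B := by
  funext x y
  by_cases hy : y ∈ JJ n
  · have h : B (-x) (-y) = 0 := by_contra fun h => neg_notMem_JJ hy (hB.1 _ _ h).2
    rw [OmegaM_of_mem hy, symExt, h, add_zero]
  · exact (if_neg hy).trans (by_contra fun h => hy (hB.1 _ _ (Ne.symm h)).2)

theorem symExt_OmegaM {m n : ℕ} {A : Mat} (hA : SymSupp m n A) : symExt (OmegaM n A) = A := by
  funext x y
  by_cases hy : y ∈ JJ n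
  · simp [symExt, OmegaM, hy, neg_notMem_JJ hy]
  · by_cases hy' : -y ∈ JJ n
    · simp [symExt, OmegaM, hy, hy', ← hA.2]
    · have h : A x y = 0 := by_contra fun h =>
        (mem_II_two_mul.1 (hA.1 x y h).2).elim hy hy'
      simp [symExt, OmegaM, hy, hy', h]

/-- The bijection `A ↦ ΩA` between the two index sets. -/
def OmegaEquiv (m n d : ℕ) : {A : Mat // A ∈ Xiι m n d} ≃ {B : Mat // B ∈ Xi2 m n d} where
  toFun A := ⟨OmegaM n A.1, (symSupp_of_mem A.2).mem_iff.1 A.2⟩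
  invFun B := ⟨symExt B.1, (symSupp_symExt B.2).mem_iff.2 ((OmegaM_symExt B.2).symm ▸ B.2)⟩
  left_inv A := Subtype.ext (symExt_OmegaM (symSupp_of_mem A.2))
  right_inv B := Subtype.ext (OmegaM_symExt B.2)

theorem OmegaT_eq_domLCongr (m n d : ℕ) :
    OmegaT m n d = (Finsupp.domLCongr (R := K) (M := K) (OmegaEquiv m n d)).toLinearMap := by
  refine Finsupp.lhom_ext' fun A => LinearMap.ext_ring ?_
  have hA := (symSupp_of_mem A.2).mem_iff.1 A.2
  simp [OmegaT_single, tP, hA, OmegaEquiv]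

theorem OmegaT_bijective (m n d : ℕ) : Function.Bijective (OmegaT m n d) := by
  rw [OmegaT_eq_domLCongr]
  exact (Finsupp.domLCongr (R := K) (M := K) (OmegaEquiv m n d)).bijective

theorem q_ne_zero : q ≠ 0 := RatFunc.X_ne_zero

theorem OmegaT_BRι {m n d : ℕ} {i : ℚ} (h₁ : i + 1 / 2 ∈ JJ n) (h₂ : i - 1 / 2 ∈ JJ n)
    (A : {A : Mat // A ∈ Xiι m n d}) :
    OmegaT m n d (BRι m (Xiι m n d) i (Finsupp.single A 1))
      = FRt m (Xi2 m n d) i (OmegaT m n d (Finsupp.single A 1)) := by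
  have hA := symSupp_of_mem A.2
  rw [OmegaT_single, BRι, FRt, opOf_single, opOf_tP _ (hA.mem_iff.1 A.2), map_sum]
  refine Finset.sum_congr rfl fun j hj => ?_
  rw [map_smul, OmegaT_tP d (hA.matMove hj (mem_II_of_mem_JJ h₂) _ _), OmegaM_matMove h₂ h₁]
  simp only [OmegaM_of_mem h₁, OmegaM_of_mem h₂]

theorem OmegaT_BRι_neg {m n d : ℕ} {i : ℚ} (h₁ : i + 1 / 2 ∈ JJ n) (h₂ : i - 1 / 2 ∈ JJ n)
    (A : {A : Mat // A ∈ Xiι m n d}) :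
    OmegaT m n d (BRι m (Xiι m n d) (-i) (Finsupp.single A 1))
      = ERt m (Xi2 m n d) i (OmegaT m n d (Finsupp.single A 1)) := by
  have hA := symSupp_of_mem A.2
  have e₁ : -i - 1 / 2 = -(i + 1 / 2) := by ring
  have e₂ : -i + 1 / 2 = -(i - 1 / 2) := by ring
  rw [OmegaT_single, BRι, ERt, opOf_single, opOf_tP _ (hA.mem_iff.1 A.2), map_sum, ← sum_II_neg]
  refine Finset.sum_congr rfl fun j hj => ?_
  rw [map_smul, e₁, e₂, OmegaT_tP d (hA.matMove (II_neg hj) (II_neg (mem_II_of_mem_JJ h₁)) _ _),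
    OmegaM_matMove_neg h₁ h₂, neg_neg, sum_II_filter_neg_lt]
  simp only [OmegaM_of_mem h₁, OmegaM_of_mem h₂, ← hA.2]

theorem OmegaT_BLι {m n d : ℕ} {i : ℚ} (hi : i ∈ II (2 * m - 1))
    (A : {A : Mat // A ∈ Xiι m n d}) :
    OmegaT m n d (BLι n (Xiι m n d) i (Finsupp.single A 1))
      = (FLt n (Xi2 m n d) i + (ELt n (Xi2 m n d) (-i)).comp (KLinv n (Xi2 m n d) i))
          (OmegaT m n d (Finsupp.single A 1)) := by
  have hA := symSupp_of_mem A.2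
  have hΩ := hA.mem_iff.1 A.2
  have e₁ : -i - 1 / 2 = -(i + 1 / 2) := by ring
  have e₂ : -i + 1 / 2 = -(i - 1 / 2) := by ring
  rw [OmegaT_single, LinearMap.add_apply, LinearMap.comp_apply, BLι, FLt, ELt, KLinv, opOf_single,
    opOf_tP _ hΩ, opOf_tP _ hΩ, map_smul, opOf_tP _ hΩ, map_sum, sum_II_two_mul, Finset.smul_sum]
  congr 1 <;> refine Finset.sum_congr rfl fun j hj => ?_
  · rw [map_smul, OmegaT_tP d (hA.matMove (add_half_mem_II hi) (mem_II_of_mem_JJ hj) _ _),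
      OmegaM_matMove hj hj, sum_II_filter_le hj, OmegaM_of_mem hj]
    congr 4
    exact Finset.sum_congr rfl fun k hk => by
      simp only [OmegaM_of_mem (Finset.mem_filter.1 hk).1]
  · rw [map_smul, OmegaT_tP d (hA.matMove (add_half_mem_II hi) (II_neg (mem_II_of_mem_JJ hj)) _ _),
      OmegaM_matMove_neg hj hj, sum_II_filter_neg_le hj, e₁, e₂, OmegaM_of_mem hj, smul_smul,
      ← mul_assoc, ← zpow_add₀ q_ne_zero, ← Finset.sum_neg_distrib, ← add_assoc,
      hA.2 (i - 1 / 2) (-j), neg_neg]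
    congr 5
    · exact Finset.sum_congr rfl fun k hk => by simp only [OmegaM_of_mem hk, neg_sub]
    · exact Finset.sum_congr rfl fun k hk => by
        simp only [OmegaM_of_mem (Finset.mem_filter.1 hk).1, hA.2 _ (-k), neg_neg]

theorem OmegaT_BL0ι {m n d : ℕ} (hm : 1 ≤ m) (A : {A : Mat // A ∈ Xiι m n d}) :
    OmegaT m n d (BL0ι n (Xiι m n d) (Finsupp.single A 1))
      = (FLt n (Xi2 m n d) 0 + q⁻¹ • (ELt n (Xi2 m n d) 0).comp (KLinv n (Xi2 m n d) 0)
          + KLinv n (Xi2 m n d) 0) (OmegaT m n d (Finsupp.single A 1)) := by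
  have hA := symSupp_of_mem A.2
  have hΩ := hA.mem_iff.1 A.2
  have hhalf : (1 / 2 : ℚ) ∈ II (2 * m) := by
    simpa only [zero_add] using add_half_mem_II (zero_mem_II hm)
  have hK : ∑ k ∈ JJ n, ((A.1 (1 / 2) k : ℤ) - (A.1 (-(1 / 2)) k : ℤ))
      = -∑ k ∈ JJ n, ((OmegaM n A.1 (-(1 / 2)) k : ℤ) - (OmegaM n A.1 (1 / 2) k : ℤ)) := by
    rw [← Finset.sum_neg_distrib]
    exact Finset.sum_congr rfl fun k hk => by simp only [OmegaM_of_mem hk, neg_sub]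
  rw [OmegaT_single, LinearMap.add_apply, LinearMap.add_apply, LinearMap.smul_apply,
    LinearMap.comp_apply, BL0ι, FLt, ELt, KLinv, opOf_single, opOf_tP _ hΩ, opOf_tP _ hΩ,
    map_smul, opOf_tP _ hΩ, map_add, map_smul, OmegaT_tP d hA, map_sum, sum_II_two_mul,
    Finset.smul_sum, Finset.smul_sum, sum_II_filter_pos, hK]
  simp only [zero_add, zero_sub]
  congr 2 <;> refine Finset.sum_congr rfl fun j hj => ?_
  · rw [map_smul, OmegaT_tP d (hA.matMove hhalf (mem_II_of_mem_JJ hj) _ _),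
      OmegaM_matMove hj hj, sum_II_filter_le hj, OmegaM_of_mem hj, if_pos (pos_of_mem_JJ hj)]
    congr 4
    exact Finset.sum_congr rfl fun k hk => by
      simp only [OmegaM_of_mem (Finset.mem_filter.1 hk).1]
  · have hneg : ¬ 0 < -j := by linarith [pos_of_mem_JJ hj]
    have hE : ∑ k ∈ (JJ n).filter (fun k => k ≤ j),
          ((A.1 (1 / 2) (-k) : ℤ) - (A.1 (-(1 / 2)) (-k) : ℤ))
        = ∑ k ∈ (JJ n).filter (fun k => k ≤ j),
          ((OmegaM n A.1 (-(1 / 2)) k : ℤ) - (OmegaM n A.1 (1 / 2) k : ℤ)) :=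
      Finset.sum_congr rfl fun k hk => by
        simp only [OmegaM_of_mem (Finset.mem_filter.1 hk).1, hA.2 _ (-k), neg_neg]
    rw [map_smul, OmegaT_tP d (hA.matMove hhalf (II_neg (mem_II_of_mem_JJ hj)) _ _),
      OmegaM_matMove_neg hj hj, sum_II_filter_neg_le hj, if_neg hneg, hK, hE, OmegaM_of_mem hj,
      smul_smul, smul_smul, hA.2 (-(1 / 2)) (-j), neg_neg, neg_neg, add_zero,
      zpow_add₀ q_ne_zero, zpow_add_one₀ q_ne_zero]
    congr 1
    have hq := q_ne_zero
    field_simp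

theorem stmt2 (m n d : ℕ) (hm : 1 ≤ m) (hn : 1 ≤ n) :
    -- Ω̃ is a linear bijection
    Function.Bijective ⇑(OmegaT m n d) ∧
    -- (1) compatibility with the right actions
    (∀ i : ℕ, 1 ≤ i → i ≤ n - 1 → ∀ A : {A : Mat // A ∈ Xiι m n d},
        OmegaT m n d (BRι m (Xiι m n d) (i : ℚ) (Finsupp.single A 1))
          = FRt m (Xi2 m n d) (i : ℚ) (OmegaT m n d (Finsupp.single A 1))
      ∧ OmegaT m n d (BRι m (Xiι m n d) (-(i : ℚ)) (Finsupp.single A 1))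
          = ERt m (Xi2 m n d) (i : ℚ) (OmegaT m n d (Finsupp.single A 1))) ∧
    -- (2) compatibility with the left action, i ≠ 0
    (∀ i ∈ II (2*m - 1), i ≠ 0 → ∀ A : {A : Mat // A ∈ Xiι m n d},
        OmegaT m n d (BLι n (Xiι m n d) i (Finsupp.single A 1))
          = (FLt n (Xi2 m n d) i
              + (ELt n (Xi2 m n d) (-i)).comp (KLinv n (Xi2 m n d) i)) (OmegaT m n d (Finsupp.single A 1))) ∧
    -- (3) compatibility with the left action of B_0
    (∀ A : {A : Mat // A ∈ Xiι m n d},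
        OmegaT m n d (BL0ι n (Xiι m n d) (Finsupp.single A 1))
          = (FLt n (Xi2 m n d) 0
              + q⁻¹ • (ELt n (Xi2 m n d) 0).comp (KLinv n (Xi2 m n d) 0)
              + KLinv n (Xi2 m n d) 0) (OmegaT m n d (Finsupp.single A 1))) := by
  refine ⟨OmegaT_bijective m n d, fun i h₁ hi A => ?_, fun i hi _ A => OmegaT_BLι hi A,
    fun A => OmegaT_BL0ι hm A⟩
  have hadd := add_half_mem_JJ hi h₁
  have hsub := sub_half_mem_JJ hi h₁
  exact ⟨OmegaT_BRι hadd hsub A, OmegaT_BRι_neg hadd hsub A⟩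

end
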